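/- If β₁ = β₋₁ = 1, then no function c : ℤ×ℤ → F satisfies equation (E). -/

import Mathlib

/-- Equation (E): `c(0,0) = 2α` together with the relation
`(−α+i+β₋₁k)c(i+k,j) + (α+j+β₁k)c(i,j+k) = (i+j−k)c(i,j)` for all integers `i,j,k`
satisfying the stated side conditions. -/
def SatE {F : Type*} [Field F] (α β₁ βm : F) (c : ℤ × ℤ → F) : Prop :=
  c (0, 0) = 2 * α ∧
  ∀ i j k : ℤ,
    ((((i : F) - α) * ((i : F) + (k : F) - α) ≠ 0 ∨ βm ∉ ({0, 1} : Set F)) ∧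
     (((j : F) + α) * ((j : F) + (k : F) + α) ≠ 0 ∨ β₁ ∉ ({0, 1} : Set F))) →
    (-α + (i : F) + βm * (k : F)) * c (i + k, j) +
      (α + (j : F) + β₁ * (k : F)) * c (i, j + k) =
      ((i : F) + (j : F) - (k : F)) * c (i, j)


theorem apply_zero_zero_eq_zero_of_relation {F : Type*} [Field F] [CharZero F] {a : F} (ha : a ≠ 1)
    {d : ℤ → ℤ → F}
    (h : ∀ i j k : ℤ, ((i : F) - a) * d (i + k) j + ((j : F) + a) * d i (j + k) =
      ((i : F) + j - k) * d i j) :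
    d 0 0 = 0 := by
  have h₁ := h 0 0 2
  have h₂ := h 0 1 1
  have h₃ := h 1 0 1
  have h₄ := h 1 1 1
  have h₅ := h 1 2 (-1)
  have h₆ := h 2 2 (-2)
  have h₇ := h 2 2 (-1)
  norm_num at h₁ h₂ h₃ h₄ h₅ h₆ h₇
  have ha' : a - 1 ≠ 0 := sub_ne_zero.2 ha
  refine (mul_eq_zero.1 ?_).resolve_left ha'
  linear_combination (a - 1) / 2 * h₁ - a * (2 * a + 3) * (a - 1) / 6 * h₂
    + a * (5 * a ^ 2 + 10 * a - 6) / 12 * h₃ - a ^ 2 * (a + 2) / 2 * h₄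
    - 3 * a ^ 3 / 4 * h₅ + 5 * a ^ 2 * (a - 1) / 12 * h₆ - a ^ 2 * (a - 1) / 2 * h₇

/-- Rescaling the index lattice by `m` turns a solution of (E) with parameter `α` into
a solution of a relation with parameter `a = α / m`. -/
theorem SatE.relation_of_eq_mul {F : Type*} [Field F] {α a : F} {c : ℤ × ℤ → F} {m : ℤ}
    (hc : SatE α 1 1 c) (hm : (m : F) ≠ 0) (hα : α = m * a) (ha : ∀ n : ℤ, (n : F) ≠ a)
    (i j k : ℤ) :
    ((i : F) - a) * (((i + k : ℤ) - a) * (j + a) * c (m * (i + k), m * j)) +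
      ((j : F) + a) * ((i - a) * ((j + k : ℤ) + a) * c (m * i, m * (j + k))) =
      ((i : F) + j - k) * ((i - a) * (j + a) * c (m * i, m * j)) := by
  have hsub (n : ℤ) : (n : F) - a ≠ 0 := sub_ne_zero.2 (ha n)
  have hadd (n : ℤ) : (n : F) + a ≠ 0 := fun hn => ha (-n) (by
    push_cast; linear_combination -hn)
  have key := hc.2 (m * i) (m * j) (m * k) ⟨Or.inl ?_, Or.inl ?_⟩
  · rw [← mul_add, ← mul_add] at key
    subst hα
    push_cast at key ⊢
    refine mul_left_cancel₀ hm ?_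
    linear_combination (i - a) * (j + a) * key
  · convert mul_ne_zero (mul_ne_zero hm (hsub i)) (mul_ne_zero hm (hsub (i + k))) using 1
    push_cast [hα]; ring
  · convert mul_ne_zero (mul_ne_zero hm (hadd j)) (mul_ne_zero hm (hadd (j + k))) using 1
    push_cast [hα]; ring

theorem exists_eq_intCast_mul_not_intCast {F : Type*} [Field F] [CharZero F] {α : F}
    (hα : α ≠ 0) :
    ∃ (m : ℤ) (a : F), (m : F) ≠ 0 ∧ α = m * a ∧ ∀ n : ℤ, (n : F) ≠ a := by
  by_cases h : ∃ n : ℤ, (n : F) = α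
  · obtain ⟨n, rfl⟩ := h
    refine ⟨2 * n, 1 / 2, by push_cast; exact mul_ne_zero two_ne_zero hα, by push_cast; ring, ?_⟩
    intro k hk
    have : ((2 * k : ℤ) : F) = (1 : ℤ) := by push_cast; rw [hk]; norm_num
    have := Int.cast_injective this
    omega
  · exact ⟨1, α, by simp, by simp, not_exists.1 h⟩

theorem stmt_12 {F : Type*} [Field F] [CharZero F] (α : F) (hα : α ≠ 0) :
    ¬∃ c : ℤ × ℤ → F, SatE α (1 : F) (1 : F) c := by
  rintro ⟨c, hc⟩
  obtain ⟨m, a, hm, hma, ha⟩ := exists_eq_intCast_mul_not_intCast hα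
  have h0 := apply_zero_zero_eq_zero_of_relation (a := a) (by simpa using (ha 1).symm)
    (d := fun i j => ((i : F) - a) * (j + a) * c (m * i, m * j))
    (hc.relation_of_eq_mul hm hma ha)
  have ha0 : a ≠ 0 := by simpa using (ha 0).symm
  simp [hc.1, hα, ha0] at h0
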